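/- (Isometry for centered marked Poisson integrals.) Let (X, 𝒳, ν) be a measurable space with all singletons measurable and ν a finite diffuse measure with 0 < ν(X) < ∞; let (Ω₀, P₀, N) be the concrete Poisson space with intensity ν, and let (R, ℛ, ρ) be a probability space. Let F: Ω₀ × X × R → ℝ be 𝒜⊗𝒳⊗ℛ-measurable with ∫ F² d(P_N × ρ) < ∞, where P_N(dω dx) = P₀(dω) N_ω(dx), and suppose ∫_R F(ω, x, r) ρ(dr) = 0 for P_N-almost every (ω, x). Then for P₀-almost every ω = (n, x_1, x_2, …): ∫_{R^{ℕ*}} ( Σ_{i=1}^n F(ω, x_i, r_i) )² ρ^{⊗ℕ*}(dr) = Σ_{i=1}^n ∫_R F(ω, x_i, r)² ρ(dr). -/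

import Mathlib

open MeasureTheory Set Finset
open scoped ENNReal

noncomputable section

/-- The Poisson law with parameter `t` on `ℕ` : `P({n}) = e^{−t} tⁿ / n!`. -/
def poissonLaw (t : ℝ) : Measure ℕ :=
  Measure.sum fun n =>
    (ENNReal.ofReal (Real.exp (-t) * t ^ n / n.factorial)) • Measure.dirac n

/-- `N(f)(ω) = Σ_{i=1}^n f(x_i)` for a point `ω = (n, x₁, x₂, …)` of the concrete
Poisson space `Ω₀ = ℕ × X^{ℕ*}` (empty sum = 0). -/
def NN {X : Type*} (f : X → ℝ) (ω : ℕ × (ℕ → X)) : ℝ :=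
  ∑ i ∈ Finset.range ω.1, f (ω.2 i)

/-- The σ-field `𝒜 = σ(N(1_A) : A ∈ 𝒳)` on the concrete Poisson space `Ω₀`. -/
def poissonSigmaAlgebra (X : Type*) [MeasurableSpace X] :
    MeasurableSpace (ℕ × (ℕ → X)) :=
  ⨆ (A : Set X) (_ : MeasurableSet A),
    MeasurableSpace.comap (NN (A.indicator fun _ => (1 : ℝ))) inferInstance

/-- The concrete Poisson probability `P₀` with finite intensity `ν` on `Ω₀ = ℕ × X^{ℕ*}`:
the product of the Poisson law of parameter `ν(X)` with the infinite product `Pseq` of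
countably many copies of the normalized measure `ν/ν(X)`. -/
def poissonP0 {X : Type*} [MeasurableSpace X] (ν : Measure X)
    (Pseq : Measure (ℕ → X)) : Measure (ℕ × (ℕ → X)) :=
  (poissonLaw (ν univ).toReal).prod Pseq

/-- `Pseq` is the infinite product of copies of the normalized measure `ν/ν(X)`,
characterized by its values on measurable cylinders. -/
def IsProductOfNormalized {X : Type*} [MeasurableSpace X] (ν : Measure X)
    (Pseq : Measure (ℕ → X)) : Prop :=
  IsProbabilityMeasure Pseq ∧
  ∀ (s : Finset ℕ) (A : ℕ → Set X), (∀ i, MeasurableSet (A i)) →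
    Pseq {x | ∀ i ∈ s, x i ∈ A i} = ∏ i ∈ s, ((ν univ)⁻¹ * ν (A i))

open ProbabilityTheory

lemma measurable_NN {X : Type*} [MeasurableSpace X] {f : X → ℝ} (hf : Measurable f) :
    Measurable (NN f) := by
  refine measurable_from_prod_countable_right fun n => ?_
  simp only [NN]
  fun_prop

lemma poissonSigmaAlgebra_le (X : Type*) [MeasurableSpace X] :
    poissonSigmaAlgebra X ≤ (inferInstance : MeasurableSpace (ℕ × (ℕ → X))) :=
  iSup₂_le fun _ hA => (measurable_NN (measurable_const.indicator hA)).comap_le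

/-- A sum of square-integrable centered functions of the coordinates of an infinite product
has second moment equal to the sum of the second moments. -/
lemma integral_sum_sq_infinitePi_of_centered {ι R : Type*} [MeasurableSpace R]
    (ρ : Measure R) [IsProbabilityMeasure ρ] (s : Finset ι) (f : ι → R → ℝ)
    (hf : ∀ i, Measurable (f i)) (hL2 : ∀ i ∈ s, MemLp (f i) 2 ρ)
    (h0 : ∀ i ∈ s, ∫ r, f i r ∂ρ = 0) :
    ∫ x, (∑ i ∈ s, f i (x i)) ^ 2 ∂(Measure.infinitePi fun _ : ι => ρ) =
      ∑ i ∈ s, ∫ r, f i r ^ 2 ∂ρ := by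
  set μ := Measure.infinitePi fun _ : ι => ρ
  have hmp : ∀ i, MeasurePreserving (fun x : ι → R => x i) μ ρ :=
    fun i => measurePreserving_eval_infinitePi (fun _ : ι => ρ) i
  have hint : ∀ i, ∀ g : R → ℝ, Measurable g → ∫ x, g (x i) ∂μ = ∫ r, g r ∂ρ := fun i g hg => by
    rw [← (hmp i).map_eq,
      integral_map (hmp i).measurable.aemeasurable hg.aestronglyMeasurable]
  have hL2' : ∀ i ∈ s, MemLp (fun x : ι → R => f i (x i)) 2 μ :=
    fun i hi => (hL2 i hi).comp_measurePreserving (hmp i)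
  have hmean : ∀ i ∈ s, ∫ x, f i (x i) ∂μ = 0 := fun i hi => by
    rw [hint i _ (hf i), h0 i hi]
  have hindep : iIndepFun (fun i (x : ι → R) => f i (x i)) μ := iIndepFun_infinitePi hf
  have hvar := IndepFun.variance_sum hL2' fun i _ j _ hij => hindep.indepFun hij
  have hsum : ∫ x, (∑ i ∈ s, fun x : ι → R => f i (x i)) x ∂μ = 0 := by
    simp only [Finset.sum_apply]
    rw [integral_finsetSum _ fun i hi => (hL2' i hi).integrable one_le_two]
    exact Finset.sum_eq_zero hmean
  rw [variance_of_integral_eq_zero (by fun_prop) hsum] at hvar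
  simp only [Finset.sum_apply] at hvar
  rw [hvar]
  refine Finset.sum_congr rfl fun i hi => ?_
  rw [variance_of_integral_eq_zero (hL2' i hi).aestronglyMeasurable.aemeasurable (hmean i hi)]
  exact hint i (fun r => f i r ^ 2) ((hf i).pow_const 2)

/-- **isometry for centered marked Poisson integrals.** On the concrete
Poisson space with finite diffuse intensity `ν`, with marks in a probability space
`(R, ℛ, ρ)` (the mark sequence carrying the infinite product `ρ∞` of copies of `ρ`), if
`F` is `𝒜⊗𝒳⊗ℛ`-measurable, `∫ F² d(P_N × ρ) < ∞` and `∫_R F(ω,x,·) dρ = 0` for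
`P_N`-a.e. `(ω,x)` (i.e. for `P₀`-a.e. `ω` and every atom `x_i` of `N_ω`), then for
`P₀`-a.e. `ω = (n, x₁, x₂, …)` : `Ê[(∫ F dN⊙ρ)²] = Σᵢ ∫ F(ω, xᵢ, ·)² dρ`. -/
theorem marked_poisson_isometry {X R : Type*} [MeasurableSpace X]
    [MeasurableSingletonClass X] [MeasurableSpace R]
    (ν : Measure X) [IsFiniteMeasure ν] (hpos : 0 < ν univ)
    (hdiffuse : ∀ x : X, ν {x} = 0)
    (Pseq : Measure (ℕ → X)) (hPseq : IsProductOfNormalized ν Pseq)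
    (ρ : Measure R) [IsProbabilityMeasure ρ]
    (ρinf : Measure (ℕ → R)) (hρinfProb : IsProbabilityMeasure ρinf)
    (hρinfCyl : ∀ (s : Finset ℕ) (A : ℕ → Set R), (∀ i, MeasurableSet (A i)) →
      ρinf {r | ∀ i ∈ s, r i ∈ A i} = ∏ i ∈ s, ρ (A i))
    (F : (ℕ × (ℕ → X)) × X × R → ℝ)
    (hFmeas : Measurable[(poissonSigmaAlgebra X).prod
      ((inferInstance : MeasurableSpace X).prod (inferInstance : MeasurableSpace R))] F)
    (hFsqPN : (∫⁻ ω, (∑ i ∈ Finset.range ω.1,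
        ∫⁻ r, ENNReal.ofReal (F (ω, ω.2 i, r) ^ 2) ∂ρ) ∂(poissonP0 ν Pseq)) < ⊤)
    (hFcentered : ∀ᵐ ω ∂(poissonP0 ν Pseq), ∀ i ∈ Finset.range ω.1,
      (∫ r, F (ω, ω.2 i, r) ∂ρ) = 0) :
    ∀ᵐ ω ∂(poissonP0 ν Pseq),
      (∫ rr, (∑ i ∈ Finset.range ω.1, F (ω, ω.2 i, rr i)) ^ 2 ∂ρinf) =
        ∑ i ∈ Finset.range ω.1, ∫ r, F (ω, ω.2 i, r) ^ 2 ∂ρ := by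
  have hρ : ρinf = Measure.infinitePi fun _ : ℕ => ρ := by
    refine Measure.eq_infinitePi _ fun s A hA => ?_
    rw [← hρinfCyl s A hA]
    rfl
  have hF : Measurable F :=
    hFmeas.mono (sup_le_sup (MeasurableSpace.comap_mono (poissonSigmaAlgebra_le X)) le_rfl) le_rfl
  have hPseq_prob := hPseq.1
  have hlint : Measurable fun ω : ℕ × (ℕ → X) => ∑ i ∈ Finset.range ω.1,
      ∫⁻ r, ENNReal.ofReal (F (ω, ω.2 i, r) ^ 2) ∂ρ := by
    refine measurable_from_prod_countable_right fun n => ?_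
    refine Finset.measurable_fun_sum (Finset.range n) fun i _ => ?_
    refine Measurable.lintegral_prod_right' (f := fun p : (ℕ → X) × R =>
      ENNReal.ofReal (F ((n, p.1), p.1 i, p.2) ^ 2)) ?_
    fun_prop
  filter_upwards [ae_lt_top hlint hFsqPN.ne, hFcentered] with ω hfin hcent
  have hmeas : ∀ i, Measurable fun r => F (ω, ω.2 i, r) := fun i => by fun_prop
  rw [hρ]
  refine integral_sum_sq_infinitePi_of_centered ρ _ (fun i r => F (ω, ω.2 i, r)) hmeas
    (fun i hi => ?_) hcent
  refine (memLp_two_iff_integrable_sq (hmeas i).aestronglyMeasurable).2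
    ⟨((hmeas i).pow_const 2).aestronglyMeasurable, ?_⟩
  rw [hasFiniteIntegral_iff_ofReal (Filter.Eventually.of_forall fun _ => sq_nonneg _)]
  exact ENNReal.sum_lt_top.1 hfin i hi
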